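/- arXiv:1501.01949 — 9 statements merged into one kernel-verified Lean document; each statement's English description precedes it below -/
import Mathlib

section
/- Let P be a directed set which does not have calibre (ω₁,ω), and let X be a topological space having a base of cardinality at most ℵ₁. Then X has a base 𝓑 = ⋃_{p∈P} 𝓑_p such that 𝓑_p ⊆ 𝓑_{p'} whenever p ≤ p' and each 𝓑_p is finite; in particular, X is P-metrizable. -/
open Set TopologicalSpace Topology

/-- A family of sets is locally finite at a point `x`: `x` has a neighborhood meeting
only finitely many members of the family. -/
def LocallyFiniteAt {X : Type*} [TopologicalSpace X] (x : X) (C : Set (Set X)) : Prop :=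
  ∃ U ∈ nhds x, {A ∈ C | (A ∩ U).Nonempty}.Finite

/-- A family of sets is locally finite in `X`. -/
def LocallyFiniteFamily {X : Type*} [TopologicalSpace X] (C : Set (Set X)) : Prop :=
  ∀ x : X, LocallyFiniteAt x C

/-- A poset is directed: every pair of elements has an upper bound. -/
def DirectedPoset (P : Type*) [Preorder P] : Prop :=
  ∀ a b : P, ∃ c : P, a ≤ c ∧ b ≤ c

/-- A poset has calibre (ω₁,ω) if every uncountable subset contains an infinite
subset with an upper bound. -/
def CalibreOmega1Omega (P : Type*) [Preorder P] : Prop :=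
  ∀ S : Set P, ¬ S.Countable → ∃ T ⊆ S, T.Infinite ∧ ∃ b : P, ∀ t ∈ T, t ≤ b

/-- A collection `C` of subsets of `X` is `P`-locally finite. -/
def PLocallyFinite (P : Type*) [Preorder P] {X : Type*} [TopologicalSpace X]
    (C : Set (Set X)) : Prop :=
  ∃ c : P → Set (Set X), (∀ p p' : P, p ≤ p' → c p ⊆ c p') ∧
    (∀ p, LocallyFiniteFamily (c p)) ∧ (⋃ p, c p) = C

def IsOpenCover {X : Type*} [TopologicalSpace X] (U : Set (Set X)) : Prop :=
  (∀ V ∈ U, IsOpen V) ∧ ⋃₀ U = univ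

def IsRefinement {X : Type*} (V U : Set (Set X)) : Prop :=
  ∀ W ∈ V, ∃ W' ∈ U, W ⊆ W'

/-- `X` is `P`-paracompact: every open cover has a `P`-locally finite open refinement. -/
def PParacompact (P : Type*) [Preorder P] (X : Type*) [TopologicalSpace X] : Prop :=
  ∀ U : Set (Set X), IsOpenCover U →
    ∃ V : Set (Set X), IsOpenCover V ∧ IsRefinement V U ∧ PLocallyFinite P V

/-- A collection is (ω₁,ω)-locally finite: every uncountable subcollection contains
an infinite locally finite subcollection. -/
def Omega1OmegaLF {X : Type*} [TopologicalSpace X] (C : Set (Set X)) : Prop :=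
  ∀ D ⊆ C, ¬ D.Countable → ∃ E ⊆ D, E.Infinite ∧ LocallyFiniteFamily E

def Omega1OmegaParacompact (X : Type*) [TopologicalSpace X] : Prop :=
  ∀ U : Set (Set X), IsOpenCover U →
    ∃ V : Set (Set X), IsOpenCover V ∧ IsRefinement V U ∧ Omega1OmegaLF V

/-- `B` is a base for the topology of `X`. -/
def IsBase {X : Type*} [TopologicalSpace X] (B : Set (Set X)) : Prop :=
  (∀ b ∈ B, IsOpen b) ∧ ∀ U : Set X, IsOpen U → ∀ x ∈ U, ∃ b ∈ B, x ∈ b ∧ b ⊆ U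

/-- `X` is `P`-metrizable: it has a `(P × ℕ)`-locally finite base. -/
def PMetrizable (P : Type*) [Preorder P] (X : Type*) [TopologicalSpace X] : Prop :=
  ∃ B : Set (Set X), IsBase B ∧ PLocallyFinite (P × ℕ) B

def Omega1OmegaMetrizable (X : Type*) [TopologicalSpace X] : Prop :=
  ∃ B : Set (Set X), IsBase B ∧ Omega1OmegaLF B

/-- Pseudocompact: every locally finite family of nonempty open sets is finite. -/
def Pseudocompact (X : Type*) [TopologicalSpace X] : Prop :=
  ∀ C : Set (Set X), (∀ U ∈ C, IsOpen U ∧ U.Nonempty) → LocallyFiniteFamily C → C.Finite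

/-- The directed set of compact subsets of `M`, ordered by inclusion. -/
abbrev KM (M : Type*) [TopologicalSpace M] : Type _ := {K : Set M // IsCompact K}

/-- `X` is 𝒦(𝓜)-paracompact: every open cover has a `𝒦(M)`-locally finite open
refinement for some separable metrizable `M`. -/
def KMclassParacompact (X : Type*) [TopologicalSpace X] : Prop :=
  ∀ U : Set (Set X), IsOpenCover U →
    ∃ (M : Type) (_ : TopologicalSpace M), SeparableSpace M ∧ MetrizableSpace M ∧
      ∃ V : Set (Set X), IsOpenCover V ∧ IsRefinement V U ∧ PLocallyFinite (KM M) V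

/-- Weakly σ-locally finite collection. -/
def WeaklySigmaLF {X : Type*} [TopologicalSpace X] (C : Set (Set X)) : Prop :=
  ∃ c : ℕ → Set (Set X), (⋃ n, c n) = C ∧
    ∀ x : X, ∀ A ∈ C, ∃ n, A ∈ c n ∧ LocallyFiniteAt x (c n)

/-- Relatively locally finite: locally finite at every point of its union. -/
def RelLocallyFinite {X : Type*} [TopologicalSpace X] (C : Set (Set X)) : Prop :=
  ∀ x ∈ ⋃₀ C, LocallyFiniteAt x C

def SigmaRelLF {X : Type*} [TopologicalSpace X] (C : Set (Set X)) : Prop :=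
  ∃ c : ℕ → Set (Set X), (⋃ n, c n) = C ∧ ∀ n, RelLocallyFinite (c n)

def SigmaRelParacompact (X : Type*) [TopologicalSpace X] : Prop :=
  ∀ U : Set (Set X), IsOpenCover U →
    ∃ V : Set (Set X), IsOpenCover V ∧ IsRefinement V U ∧ SigmaRelLF V

/-- An open set `U` is `P`-regular. -/
def PRegular (P : Type*) [Preorder P] {X : Type*} [TopologicalSpace X] (U : Set X) : Prop :=
  ∃ V : P × ℕ → Set X, (∀ q, IsOpen (V q)) ∧ (∀ q q' : P × ℕ, q ≤ q' → V q ⊆ V q') ∧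
    (⋃ q, V q) = U ∧ (⋃ q, closure (V q)) = U

def PPerfectlyNormal (P : Type*) [Preorder P] (X : Type*) [TopologicalSpace X] : Prop :=
  ∀ U : Set X, IsOpen U → PRegular P U

/-- A development for `X`. -/
def IsDevelopment {X : Type*} [TopologicalSpace X] (G : ℕ → Set (Set X)) : Prop :=
  (∀ n, IsOpenCover (G n)) ∧
    ∀ (x : X) (U : Set X), IsOpen U → x ∈ U → ∃ n, ⋃₀ {g ∈ G n | x ∈ g} ⊆ U

/-- A Moore space is a regular Hausdorff space with a development; here we record
just the existence of a development (regularity is a separate hypothesis). -/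
def HasDevelopment (X : Type*) [TopologicalSpace X] : Prop :=
  ∃ G : ℕ → Set (Set X), IsDevelopment G

/-- Countably paracompact: every countable open cover has a locally finite open refinement. -/
def CountablyParacompact (X : Type*) [TopologicalSpace X] : Prop :=
  ∀ U : Set (Set X), IsOpenCover U → U.Countable →
    ∃ V : Set (Set X), IsOpenCover V ∧ IsRefinement V U ∧ LocallyFiniteFamily V

/-- ccc: every pairwise disjoint family of nonempty open sets is countable. -/
def CCC (X : Type*) [TopologicalSpace X] : Prop :=
  ∀ C : Set (Set X), (∀ U ∈ C, IsOpen U ∧ U.Nonempty) → C.Pairwise Disjoint → C.Countable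

/-- Cofinal subset of a preorder. -/
def CofinalSet {P : Type*} [Preorder P] (C : Set P) : Prop :=
  ∀ p : P, ∃ c ∈ C, p ≤ c

/-- `Q` is a Tukey quotient of `P`. -/
def TukeyQuotient (P : Type*) [Preorder P] (Q : Type*) [Preorder Q] : Prop :=
  ∃ φ : P → Q, ∀ C : Set P, CofinalSet C → CofinalSet (φ '' C)
/-- If the directed set `P` does not have calibre (ω₁,ω) and `X` has a base
of cardinality at most ℵ₁, then `X` has a `P`-ordered base with finite levels; in
particular `X` is `P`-metrizable. -/
theorem statement2 (P : Type*) [PartialOrder P] (hdir : DirectedPoset P)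
    (hcal : ¬ CalibreOmega1Omega P)
    (X : Type*) [TopologicalSpace X]
    (hbase : ∃ B : Set (Set X), IsBase B ∧ Cardinal.mk B ≤ Cardinal.aleph 1) :
    (∃ c : P → Set (Set X), (∀ p p' : P, p ≤ p' → c p ⊆ c p') ∧
      (∀ p, (c p).Finite) ∧ IsBase (⋃ p, c p)) ∧
    PMetrizable P X := by
  obtain ⟨B, hB, hcard⟩ := hbase
  unfold CalibreOmega1Omega at hcal
  push Not at hcal
  obtain ⟨S, hS, hS'⟩ := hcal
  have h1 : Cardinal.aleph 1 ≤ Cardinal.mk S := by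
    rw [← Set.countable_coe_iff, ← Cardinal.mk_le_aleph0_iff, not_le] at hS
    rw [← Cardinal.succ_aleph0]
    exact Order.succ_le_of_lt hS
  have h2 : Cardinal.lift.{u_1} (Cardinal.mk B) ≤ Cardinal.lift.{u_2} (Cardinal.mk S) := by
    have a := Cardinal.lift_le.{u_1}.2 hcard
    have b := Cardinal.lift_le.{u_2}.2 h1
    simp only [Cardinal.lift_aleph, Ordinal.lift_one] at a b
    exact a.trans b
  obtain ⟨f⟩ := Cardinal.lift_mk_le'.1 h2
  let c : P → Set (Set X) := fun p => {b | ∃ h : b ∈ B, (f ⟨b, h⟩ : P) ≤ p}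
  have hmono : ∀ p p' : P, p ≤ p' → c p ⊆ c p' := by
    rintro p p' hpp b ⟨h, hb⟩
    exact ⟨h, hb.trans hpp⟩
  have hfin : ∀ p, (c p).Finite := by
    intro p
    have hT : {t ∈ S | t ≤ p}.Finite := by
      by_contra hinf
      obtain ⟨t, ht, ht'⟩ := hS' {t ∈ S | t ≤ p} (fun t ht => ht.1) hinf p
      exact ht' ht.2
    have hpre : ((fun b : B => (f b : P)) ⁻¹' {t ∈ S | t ≤ p}).Finite :=
      hT.preimage (Subtype.val_injective.comp f.injective).injOn
    refine (hpre.image Subtype.val).subset ?_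
    rintro b ⟨h, hb⟩
    exact ⟨⟨b, h⟩, ⟨(f ⟨b, h⟩).2, hb⟩, rfl⟩
  have hU : (⋃ p, c p) = B := by
    ext b
    simp only [mem_iUnion]
    constructor
    · rintro ⟨p, h, -⟩
      exact h
    · intro h
      exact ⟨_, h, le_rfl⟩
  refine ⟨⟨c, hmono, hfin, hU ▸ hB⟩, B, hB, fun q => c q.1, fun p p' h => hmono _ _ h.1, ?_, ?_⟩
  · intro q x
    exact ⟨univ, Filter.univ_mem, (hfin q.1).subset fun A hA => hA.1⟩
  · rw [← hU]
    ext b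
    simp
end

section
/- If κ is an uncountable cardinal, then A(κ)²∖Δ is not (ω₁,ω)-paracompact. -/
open Set TopologicalSpace Topology

theorem tendsto_coe_cofinite_aux (D : Type*) [TopologicalSpace D] [DiscreteTopology D] :
    Filter.Tendsto (fun d : D => (d : OnePoint D)) Filter.cofinite (𝓝 (OnePoint.infty)) := by
  have h := OnePoint.tendsto_coe_infty (X := D)
  rwa [Filter.coclosedCompact_eq_cocompact, Filter.cocompact_eq_cofinite] at h

/-- For an uncountable cardinal κ (represented by an uncountable discrete
space `D`), `A(κ)² ∖ Δ` is not (ω₁,ω)-paracompact, where `A(κ)` is the one-point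
compactification of `D`. -/
theorem statement3 (D : Type*) [TopologicalSpace D] [DiscreteTopology D] [Uncountable D] :
    ¬ Omega1OmegaParacompact {p : OnePoint D × OnePoint D // p.1 ≠ p.2} := by
  intro hpar
  let X := {p : OnePoint D × OnePoint D // p.1 ≠ p.2}
  let R : D → Set X := fun a => {p | p.1.1 = (a : OnePoint D)}
  let Q : Set X := {p | p.1.2 ≠ OnePoint.infty}
  have hT := tendsto_coe_cofinite_aux D
  have hc1 : Continuous (fun p : X => p.1.1) := continuous_fst.comp continuous_subtype_val
  have hc2 : Continuous (fun p : X => p.1.2) := continuous_snd.comp continuous_subtype_val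
  have hsing : ∀ a : D, IsOpen ({(a : OnePoint D)} : Set (OnePoint D)) := by
    intro a
    have := OnePoint.isOpenEmbedding_coe.isOpenMap {a} (isOpen_discrete _)
    simpa using this
  have hR : ∀ a, IsOpen (R a) := fun a => (hsing a).preimage hc1
  have hQ : IsOpen Q := (isOpen_compl_singleton (x := (OnePoint.infty : OnePoint D))).preimage hc2
  obtain ⟨V, ⟨hVo, hVc⟩, hVr, hV⟩ := hpar (insert Q (range R)) ⟨by
      rintro W (rfl | ⟨a, rfl⟩)
      · exact hQ
      · exact hR a, by
      rw [eq_univ_iff_forall]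
      intro p
      by_cases h : p.1.2 = OnePoint.infty
      · have h1 : p.1.1 ≠ OnePoint.infty := fun h' => p.2 (h'.trans h.symm)
        obtain ⟨a, ha⟩ := OnePoint.ne_infty_iff_exists.1 h1
        exact ⟨R a, Or.inr ⟨a, rfl⟩, ha.symm⟩
      · exact ⟨Q, Or.inl rfl, h⟩⟩
  let P : D → X := fun a => ⟨((a : OnePoint D), OnePoint.infty), OnePoint.coe_ne_infty a⟩
  have hex : ∀ a, ∃ W ∈ V, P a ∈ W := fun a => by
    have : P a ∈ ⋃₀ V := hVc ▸ mem_univ _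
    exact this
  choose W hWV hPW using hex
  have hWR : ∀ a, W a ⊆ R a := by
    intro a
    obtain ⟨U, hU, hWU⟩ := hVr _ (hWV a)
    rcases hU with rfl | ⟨b, rfl⟩
    · exact absurd rfl (hWU (hPW a))
    · have h : (a : OnePoint D) = b := hWU (hPW a)
      rw [OnePoint.coe_eq_coe] at h
      subst h
      exact hWU
  have hinj : Function.Injective W := by
    intro a b h
    have h2 : P a ∈ R b := hWR b (h ▸ hPW a)
    exact OnePoint.coe_eq_coe.1 h2
  -- finite exceptional sets
  have hF : ∀ a : D, {b : D | ∃ h : (a : OnePoint D) ≠ b,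
      (⟨((a : OnePoint D), (b : OnePoint D)), h⟩ : X) ∉ W a}.Finite := by
    intro a
    have hn : W a ∈ 𝓝 (P a) := (hVo _ (hWV a)).mem_nhds (hPW a)
    obtain ⟨O, hO, hOW⟩ := (mem_nhds_induced _ _ _).1 hn
    have ht : Filter.Tendsto (fun b : D => ((a : OnePoint D), (b : OnePoint D)))
        Filter.cofinite (𝓝 ((a : OnePoint D), OnePoint.infty)) :=
      tendsto_const_nhds.prodMk_nhds hT
    have := Filter.mem_cofinite.1 (ht hO)
    refine this.subset ?_
    rintro b ⟨h, hb⟩ hb'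
    exact hb (hOW hb')
  have hunc : ¬ (range W).Countable := by
    intro h
    have : Countable D := by
      rw [← image_univ] at h
      exact countable_univ_iff.1 (countable_of_injective_of_countable_image hinj.injOn h)
    exact not_countable this
  obtain ⟨E, hE, hEinf, hElf⟩ := hV (range W) (by rintro _ ⟨a, rfl⟩; exact hWV a) hunc
  have hSinf : (W ⁻¹' E).Infinite := hEinf.preimage hE
  obtain ⟨S, hSE, hSi, hSc⟩ : ∃ S ⊆ W ⁻¹' E, S.Infinite ∧ S.Countable := by
    let f := hSinf.natEmbedding
    refine ⟨range (fun n => (f n : D)), ?_, ?_, countable_range _⟩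
    · rintro _ ⟨n, rfl⟩
      exact (f n).2
    · exact infinite_range_of_injective (Subtype.val_injective.comp f.injective)
  have hcount : (S ∪ ⋃ a ∈ S, {b : D | ∃ h : (a : OnePoint D) ≠ b,
      (⟨((a : OnePoint D), (b : OnePoint D)), h⟩ : X) ∉ W a}).Countable :=
    hSc.union (hSc.biUnion fun a _ => (hF a).countable)
  obtain ⟨b, hb⟩ : ∃ b, b ∉ (S ∪ ⋃ a ∈ S, {b : D | ∃ h : (a : OnePoint D) ≠ b,
      (⟨((a : OnePoint D), (b : OnePoint D)), h⟩ : X) ∉ W a}) := by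
    by_contra! hall
    exact not_countable (countable_univ_iff.1 (hcount.mono fun x _ => hall x))
  have hbS : b ∉ S := fun h => hb (Or.inl h)
  have hbW : ∀ a ∈ S, ∀ h : (a : OnePoint D) ≠ b,
      (⟨((a : OnePoint D), (b : OnePoint D)), h⟩ : X) ∈ W a := by
    intro a ha h
    by_contra hn
    exact hb (Or.inr (mem_biUnion ha ⟨h, hn⟩))
  obtain ⟨N, hN, hfin⟩ := hElf ⟨(OnePoint.infty, (b : OnePoint D)), OnePoint.infty_ne_coe b⟩
  obtain ⟨O, hO, hON⟩ := (mem_nhds_induced _ _ _).1 hN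
  have ht : Filter.Tendsto (fun a : D => ((a : OnePoint D), (b : OnePoint D)))
      Filter.cofinite (𝓝 (OnePoint.infty, (b : OnePoint D))) :=
    hT.prodMk_nhds tendsto_const_nhds
  have hco := Filter.mem_cofinite.1 (ht hO)
  have hbig := hSi.diff hco
  refine hbig ((hfin.preimage hinj.injOn).subset ?_)
  rintro a ⟨haS, haO⟩
  have haO' := not_not.1 haO
  have hab : (a : OnePoint D) ≠ b := by
    rw [Ne, OnePoint.coe_eq_coe]
    rintro rfl
    exact hbS haS
  exact ⟨hSE haS, ⟨((a : OnePoint D), (b : OnePoint D)), hab⟩, hbW a haS hab, hON haO'⟩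
end

section
/- Let X be a pseudocompact Tychonoff space. If X is (ω₁,ω)-paracompact, then X is compact. If X is (ω₁,ω)-metrizable, then X is metrizable. -/
open Set TopologicalSpace Topology

/-- In a pseudocompact space an (ω₁,ω)-locally finite open family is countable. -/
theorem countable_of_lf {X : Type*} [TopologicalSpace X] (hpc : Pseudocompact X)
    (V : Set (Set X)) (hV : ∀ v ∈ V, IsOpen v) (h : Omega1OmegaLF V) : V.Countable := by
  have h1 : (V \ {∅}).Countable := by
    by_contra hc
    obtain ⟨E, hE, hinf, hlf⟩ := h _ diff_subset hc
    exact hinf (hpc E (fun U hU => ⟨hV U (hE hU).1,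
      nonempty_iff_ne_empty.2 (fun h0 => (hE hU).2 h0)⟩) hlf)
  refine (h1.union (countable_singleton (∅ : Set X))).mono ?_
  intro v hv
  by_cases h0 : v = ∅
  · exact Or.inr h0
  · exact Or.inl ⟨hv, h0⟩

/-- In a pseudocompact space, finitely many closures of a countable open cover suffice. -/
theorem exists_closure_cover {X : Type*} [TopologicalSpace X] (hpc : Pseudocompact X)
    (f : ℕ → Set X) (hf : ∀ n, IsOpen (f n)) (hc : ∀ x, ∃ n, x ∈ f n) :
    ∃ n : ℕ, ∀ x, ∃ i ≤ n, x ∈ closure (f i) := by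
  by_contra! hne
  let O : ℕ → Set X := fun n => ⋂ i ∈ Iic n, (closure (f i))ᶜ
  have hO : ∀ n x, x ∈ O n ↔ ∀ i ≤ n, x ∉ closure (f i) := by
    intro n x; simp [O]
  have hOo : ∀ n, IsOpen (O n) := fun n =>
    (finite_Iic n).isOpen_biInter (fun i _ => isClosed_closure.isOpen_compl)
  have hOn : ∀ n, (O n).Nonempty := fun n => by
    obtain ⟨x, hx⟩ := hne n
    exact ⟨x, (hO n x).2 hx⟩
  have hfin : (range O).Finite := by
    apply hpc
    · rintro _ ⟨n, rfl⟩
      exact ⟨hOo n, hOn n⟩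
    · intro x
      obtain ⟨k, hk⟩ := hc x
      refine ⟨f k, (hf k).mem_nhds hk, ((finite_Iio k).image O).subset ?_⟩
      rintro _ ⟨⟨n, rfl⟩, y, hy, hyk⟩
      refine ⟨n, ?_, rfl⟩
      by_contra hkn
      exact (hO n y).1 hy k (not_lt.1 hkn) (subset_closure hyk)
  obtain ⟨_, ⟨n, rfl⟩, hinf⟩ : ∃ s ∈ range O, (O ⁻¹' {s}).Infinite := by
    by_contra! hcon
    have := hfin.biUnion (t := fun s => O ⁻¹' {s}) (fun s hs => by simpa using hcon s hs)
    exact infinite_univ (this.subset (fun m _ => mem_biUnion (mem_range_self m) rfl))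
  obtain ⟨x, hx⟩ := hOn n
  obtain ⟨k, hk⟩ := hc x
  obtain ⟨m, hm, hkm⟩ := hinf.exists_gt k
  have hm' : O m = O n := hm
  rw [← hm'] at hx
  exact (hO m x).1 hx k hkm.le (subset_closure hk)

/-- A pseudocompact Tychonoff space which is (ω₁,ω)-paracompact is
compact, and one which is (ω₁,ω)-metrizable is metrizable. -/
theorem statement5 (X : Type*) [TopologicalSpace X] [T35Space X]
    (hpc : Pseudocompact X) :
    (Omega1OmegaParacompact X → CompactSpace X) ∧
    (Omega1OmegaMetrizable X → MetrizableSpace X) := by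
  constructor
  · intro hp
    refine ⟨isCompact_of_finite_subcover ?_⟩
    intro ι U hU hcov
    obtain ⟨V, hV, hVW, hVlf⟩ := hp {w | IsOpen w ∧ ∃ i, closure w ⊆ U i} (by
      refine ⟨fun v hv => hv.1, eq_univ_of_forall fun x => ?_⟩
      obtain ⟨i, hi⟩ := mem_iUnion.1 (hcov (mem_univ x))
      obtain ⟨C, hC, hCc, hCU⟩ := exists_mem_nhds_isClosed_subset ((hU i).mem_nhds hi)
      exact ⟨interior C, ⟨isOpen_interior, i,
        (closure_minimal interior_subset hCc).trans hCU⟩, mem_interior_iff_mem_nhds.2 hC⟩)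
    have hVc := countable_of_lf hpc V hV.1 hVlf
    rcases V.eq_empty_or_nonempty with h0 | hne
    · refine ⟨∅, fun x _ => ?_⟩
      have hx : x ∈ ⋃₀ V := by rw [hV.2]; trivial
      simp [h0] at hx
    · obtain ⟨f, rfl⟩ := hVc.exists_eq_range hne
      have hfU : ∀ n, ∃ i, closure (f n) ⊆ U i := by
        intro n
        obtain ⟨w, ⟨_, i, hi⟩, hw⟩ := hVW _ (mem_range_self n)
        exact ⟨i, (closure_mono hw).trans hi⟩
      choose g hg using hfU
      obtain ⟨n, hn⟩ := exists_closure_cover hpc f (fun n => hV.1 _ (mem_range_self n)) (by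
        intro x
        have hx : x ∈ ⋃₀ range f := by rw [hV.2]; trivial
        obtain ⟨_, ⟨k, rfl⟩, hk⟩ := hx
        exact ⟨k, hk⟩)
      classical
      refine ⟨(Finset.range (n + 1)).image g, fun x _ => ?_⟩
      obtain ⟨i, hi, hxi⟩ := hn x
      exact mem_biUnion (Finset.mem_coe.2 (Finset.mem_image_of_mem g
        (Finset.mem_range.2 (Nat.lt_succ_of_le hi)))) (hg i hxi)
  · rintro ⟨B, hB, hlf⟩
    have hBc := countable_of_lf hpc B hB.1 hlf
    have hbasis : IsTopologicalBasis B :=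
      isTopologicalBasis_of_isOpen_of_nhds hB.1 (fun x U hx hU => hB.2 U hU x hx)
    have : SecondCountableTopology X := hbasis.secondCountableTopology hBc
    infer_instance
end

section
/- Suppose X is a first countable topological space, M is a separable metrizable space, and 𝒱 = ⋃_{K∈𝒦(M)} 𝒱_K is a 𝒦(M)-locally finite family of subsets of X (so 𝒱_K ⊆ 𝒱_L whenever K ⊆ L and each 𝒱_K is locally finite in X). Then for every x ∈ X and every K ∈ 𝒦(M), there exists an open neighborhood T of K in 𝒦(M) (with the Vietoris topology, equivalently the topology induced by the Hausdorff metric) such that ⋃{𝒱_L : L ∈ T} is locally finite at x (i.e. x has a neighborhood meeting only finitely many members of this family). -/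
open Set TopologicalSpace Topology

/-- The Vietoris topology on the hyperspace `𝒦(M)` of compact subsets of `M`. -/
def vietoris (M : Type*) [TopologicalSpace M] : TopologicalSpace (KM M) :=
  TopologicalSpace.generateFrom
    ({T | ∃ U : Set M, IsOpen U ∧ T = {K : KM M | (K : Set M) ⊆ U}} ∪
     {T | ∃ U : Set M, IsOpen U ∧ T = {K : KM M | ((K : Set M) ∩ U).Nonempty}})

theorem isCompact_union_shrinking {M : Type*} [PseudoMetricSpace M] {K : Set M}
    (hK : IsCompact K) (L : ℕ → Set M) (hL : ∀ n, IsCompact (L n)) (u : ℕ → ℝ)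
    (hu : Filter.Tendsto u Filter.atTop (nhds 0))
    (hLu : ∀ n, L n ⊆ Metric.thickening (u n) K) : IsCompact (K ∪ ⋃ n, L n) := by
  classical
  apply isCompact_of_finite_subcover
  intro ι U hU hcov
  obtain ⟨t0, ht0⟩ := hK.elim_finite_subcover U hU (subset_union_left.trans hcov)
  obtain ⟨δ, hδ, hsub⟩ := hK.exists_thickening_subset_open
    (isOpen_biUnion (fun i (_ : i ∈ t0) => hU i)) ht0
  obtain ⟨N, hN⟩ := Filter.eventually_atTop.1 (hu.eventually (gt_mem_nhds hδ))
  have hc : IsCompact (⋃ n ∈ Finset.range N, L n) :=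
    (Finset.range N).isCompact_biUnion (fun n _ => hL n)
  obtain ⟨t1, ht1⟩ := hc.elim_finite_subcover U hU (by
    refine Subset.trans ?_ hcov
    refine Subset.trans ?_ subset_union_right
    exact iUnion₂_subset fun n _ => subset_iUnion L n)
  have m0 : (⋃ i ∈ t0, U i) ⊆ ⋃ i ∈ t0 ∪ t1, U i :=
    biUnion_mono (fun i hi => by simpa using Or.inl hi) (fun _ _ => Subset.rfl)
  have m1 : (⋃ i ∈ t1, U i) ⊆ ⋃ i ∈ t0 ∪ t1, U i :=
    biUnion_mono (fun i hi => by simpa using Or.inr hi) (fun _ _ => Subset.rfl)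
  refine ⟨t0 ∪ t1, union_subset (ht0.trans m0) (iUnion_subset fun n => ?_)⟩
  by_cases hn : n < N
  · refine Subset.trans ?_ (ht1.trans m1)
    exact subset_biUnion_of_mem (u := L) (Finset.mem_coe.2 (Finset.mem_range.2 hn))
  · exact (hLu n).trans ((Metric.thickening_mono (hN n (not_lt.1 hn)).le K).trans (hsub.trans m0))

/-- If `X` is first countable and `𝒱 = ⋃_{K ∈ 𝒦(M)} 𝒱_K` is a
`𝒦(M)`-locally finite family of subsets of `X`, then for every `x ∈ X` and `K ∈ 𝒦(M)`
there is an open (Vietoris) neighborhood `T` of `K` in `𝒦(M)` such that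
`⋃ {𝒱_L : L ∈ T}` is locally finite at `x`. -/
theorem statement6 (X : Type*) [TopologicalSpace X] [FirstCountableTopology X]
    (M : Type*) [TopologicalSpace M] [SeparableSpace M] [MetrizableSpace M]
    (V : KM M → Set (Set X))
    (hmono : ∀ K L : KM M, K ≤ L → V K ⊆ V L)
    (hlf : ∀ K : KM M, LocallyFiniteFamily (V K)) :
    ∀ (x : X) (K : KM M), ∃ T : Set (KM M),
      IsOpen[vietoris M] T ∧ K ∈ T ∧ LocallyFiniteAt x (⋃ L ∈ T, V L) := by
  intro x K
  letI : MetricSpace M := TopologicalSpace.metrizableSpaceMetric M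
  obtain ⟨u, -, hu0, hu⟩ := exists_seq_strictAnti_tendsto (0 : ℝ)
  obtain ⟨B, hB⟩ := (nhds x).exists_antitone_basis
  by_contra hcon
  push Not at hcon
  have hS : ∀ n, {A ∈ ⋃ L ∈ {L : KM M | (L : Set M) ⊆ Metric.thickening (u n) (K : Set M)}, V L |
      (A ∩ B n).Nonempty}.Infinite := by
    intro n hfin
    refine hcon {L : KM M | (L : Set M) ⊆ Metric.thickening (u n) (K : Set M)} ?_ ?_
      ⟨B n, hB.1.mem_of_mem trivial, hfin⟩
    · exact TopologicalSpace.isOpen_generateFrom_of_mem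
        (Or.inl ⟨_, Metric.isOpen_thickening, rfl⟩)
    · exact Metric.self_subset_thickening (hu0 n) _
  obtain ⟨f, hf, hr⟩ := exists_seq_of_forall_finset_exists
    (fun p : ℕ × Set X => p.2 ∈ {A ∈ ⋃ L ∈ {L : KM M | (L : Set M) ⊆
      Metric.thickening (u p.1) (K : Set M)}, V L | (A ∩ B p.1).Nonempty})
    (fun p q => p.1 < q.1 ∧ p.2 ≠ q.2) (by
      classical
      intro s _
      obtain ⟨A, hA, hAs⟩ := (hS (s.sup Prod.fst + 1)).exists_notMem_finset (s.image Prod.snd)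
      refine ⟨(s.sup Prod.fst + 1, A), hA, fun p hp => ⟨?_, ?_⟩⟩
      · exact Nat.lt_succ_of_le (Finset.le_sup (f := Prod.fst) hp)
      · rintro rfl
        exact hAs (Finset.mem_image_of_mem _ hp))
  have hmonof : StrictMono (fun n => (f n).1) := fun m n h => (hr m n h).1
  have hinj : Function.Injective (fun n => (f n).2) :=
    Function.Injective.of_lt_imp_ne fun m n h => (hr m n h).2
  have hex : ∀ n, ∃ L : KM M, (L : Set M) ⊆ Metric.thickening (u (f n).1) (K : Set M) ∧
      (f n).2 ∈ V L := by
    intro n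
    have := (hf n).1
    simpa using this
  choose L hL hfL using hex
  have hc : IsCompact ((K : Set M) ∪ ⋃ n, (L n : Set M)) :=
    isCompact_union_shrinking K.2 (fun n => (L n : Set M)) (fun n => (L n).2)
      (fun n => u (f n).1) (hu.comp hmonof.tendsto_atTop) hL
  obtain ⟨W, hW, hfin⟩ := hlf ⟨_, hc⟩ x
  obtain ⟨N, -, hN⟩ := hB.1.mem_iff.1 hW
  refine ((Set.Ici_infinite N).image hinj.injOn) (hfin.subset ?_)
  rintro _ ⟨n, hn, rfl⟩
  refine ⟨hmono (L n) _ ?_ (hfL n), (hf n).2.mono (inter_subset_inter_right _ ?_)⟩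
  · exact (subset_iUnion (fun n => (L n : Set M)) n).trans subset_union_right
  · exact (hB.2 (le_trans hn (hmonof.id_le n))).trans hN
end

section
/- Let 𝒱 be a collection of subsets of a topological space X. If 𝒱 is weakly σ-locally finite, then 𝒱 is 𝒦(M)-locally finite for some separable metrizable space M. Conversely, if X is first countable and 𝒱 is 𝒦(M)-locally finite for some separable metrizable space M, then 𝒱 is weakly σ-locally finite. -/
open Set TopologicalSpace Topology

lemma wslf_forward (X : Type*) [TopologicalSpace X] (V : Set (Set X)) (h : WeaklySigmaLF V) :
      ∃ (M : Type) (_ : TopologicalSpace M), SeparableSpace M ∧ MetrizableSpace M ∧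
        PLocallyFinite (KM M) V := by
  classical
  obtain ⟨c, hc, hx⟩ := h
  let M : Type := {S : ℕ → Bool // ∀ x : X, ∃ n, S n = true ∧ LocallyFiniteAt x (c n)}
  have i1 : SecondCountableTopology M := IsEmbedding.subtypeVal.secondCountableTopology
  refine ⟨M, instTopologicalSpaceSubtype, inferInstance, IsEmbedding.subtypeVal.metrizableSpace, ?_⟩
  let s : Set X → ℕ → Bool := fun A n => decide (A ∈ c n)
  refine ⟨fun K => {A | A ∈ V ∧ ∃ m ∈ K.1, m.1 = s A}, ?_, ?_, ?_⟩
  · rintro p q hpq A ⟨hA, m, hm, hmA⟩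
    exact ⟨hA, m, hpq hm, hmA⟩
  · rintro ⟨K, hK⟩ x
    let T := {n : ℕ // LocallyFiniteAt x (c n)}
    obtain ⟨t, ht⟩ := hK.elim_finite_subcover (fun n : T => {m : M | m.1 n.1 = true})
      (fun n => by
        have : Continuous (fun m : M => m.1 n.1) := (continuous_apply n.1).comp continuous_subtype_val
        exact (isOpen_discrete ({true} : Set Bool)).preimage this)
      (by
        intro m _
        obtain ⟨n, h1, h2⟩ := m.2 x
        exact mem_iUnion.2 ⟨⟨n, h2⟩, h1⟩)
    choose U hU hfin using fun n : T => n.2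
    refine ⟨⋂ n ∈ t, U n, (Filter.biInter_finset_mem t).2 fun n _ => hU n, ?_⟩
    refine (t.finite_toSet.biUnion fun n _ => hfin n).subset ?_
    rintro A ⟨⟨hA, m, hm, hmA⟩, y, hyA, hy⟩
    have := ht hm
    simp only [mem_iUnion, mem_setOf_eq] at this
    obtain ⟨n, hn, hmn⟩ := this
    rw [hmA] at hmn
    simp only [mem_iInter] at hy
    exact mem_biUnion hn ⟨by simpa [s] using hmn, y, hyA, hy n hn⟩
  · ext A
    simp only [mem_iUnion]
    constructor
    · rintro ⟨K, hA, _⟩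
      exact hA
    · intro hA
      refine ⟨⟨{(⟨s A, fun x => ?_⟩ : M)}, isCompact_singleton⟩, hA, _, rfl, rfl⟩
      obtain ⟨n, h1, h2⟩ := hx x A hA
      exact ⟨n, by simpa [s] using h1, h2⟩

lemma exists_W (M : Type*) [TopologicalSpace M] [SecondCountableTopology M] :
    ∃ W : ℕ → Set M, (∀ n, IsOpen (W n)) ∧ ∀ K O : Set M, IsCompact K → IsOpen O → K ⊆ O →
      ∃ n, K ⊆ W n ∧ W n ⊆ O := by
  have hB := isBasis_countableBasis M
  have hcount : {F : Set (Set M) | F.Finite ∧ F ⊆ countableBasis M}.Countable :=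
    countable_setOf_finite_subset (countable_countableBasis M)
  obtain ⟨f, hf⟩ := hcount.exists_eq_range ⟨∅, finite_empty, empty_subset _⟩
  have hmem : ∀ n, (f n).Finite ∧ f n ⊆ countableBasis M := fun n => by
    have : f n ∈ range f := ⟨n, rfl⟩
    rw [← hf] at this
    exact this
  refine ⟨fun n => ⋃₀ f n, fun n => isOpen_sUnion fun s hs => hB.isOpen ((hmem n).2 hs), ?_⟩
  intro K O hK hO hKO
  have : ∃ F : Set (Set M), (F.Finite ∧ F ⊆ countableBasis M) ∧ K ⊆ ⋃₀ F ∧ ⋃₀ F ⊆ O := by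
    refine hK.induction_on (p := fun s => ∃ F : Set (Set M), (F.Finite ∧ F ⊆ countableBasis M) ∧
      s ⊆ ⋃₀ F ∧ ⋃₀ F ⊆ O) ?_ ?_ ?_ ?_
    · exact ⟨∅, ⟨finite_empty, empty_subset _⟩, empty_subset _, by simp⟩
    · rintro s t hst ⟨F, h1, h2, h3⟩
      exact ⟨F, h1, hst.trans h2, h3⟩
    · rintro s t ⟨F, h1, h2, h3⟩ ⟨G, g1, g2, g3⟩
      refine ⟨F ∪ G, ⟨h1.1.union g1.1, union_subset h1.2 g1.2⟩, ?_, ?_⟩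
      · rw [sUnion_union]; exact union_subset_union h2 g2
      · rw [sUnion_union]; exact union_subset h3 g3
    · intro x hx
      obtain ⟨b, hb, hxb, hbO⟩ := hB.exists_subset_of_mem_open (hKO hx) hO
      refine ⟨b, mem_nhdsWithin_of_mem_nhds ((hB.isOpen hb).mem_nhds hxb), {b},
        ⟨finite_singleton _, by simpa using hb⟩, by simp, by simpa using hbO⟩
  obtain ⟨F, h1, h2, h3⟩ := this
  have : F ∈ range f := by rw [← hf]; exact h1
  obtain ⟨n, rfl⟩ := this
  exact ⟨n, h2, h3⟩

lemma compact_union_seq {M : Type*} [TopologicalSpace M] (K : Set M) (hK : IsCompact K)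
    (L : ℕ → Set M) (hL : ∀ n, IsCompact (L n))
    (h : ∀ O : Set M, IsOpen O → K ⊆ O → ∃ N, ∀ n ≥ N, L n ⊆ O) :
    IsCompact (K ∪ ⋃ n, L n) := by
  classical
  refine isCompact_of_finite_subcover ?_
  intro ι U hU hcov
  obtain ⟨t, ht⟩ := hK.elim_finite_subcover U hU (subset_union_left.trans hcov)
  obtain ⟨N, hN⟩ := h _ (isOpen_biUnion fun i (_ : i ∈ t) => hU i) ht
  obtain ⟨t', ht'⟩ := ((Set.finite_lt_nat N).isCompact_biUnion
    fun n _ => hL n).elim_finite_subcover U hU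
    ((iUnion₂_subset fun n _ => subset_iUnion L n).trans (subset_union_right.trans hcov))
  refine ⟨t ∪ t', ?_⟩
  have e1 : (⋃ i ∈ t, U i) ⊆ ⋃ i ∈ t ∪ t', U i :=
    biUnion_subset_biUnion_left fun i hi => Finset.mem_union_left _ hi
  have e2 : (⋃ i ∈ t', U i) ⊆ ⋃ i ∈ t ∪ t', U i :=
    biUnion_subset_biUnion_left fun i hi => Finset.mem_union_right _ hi
  refine union_subset (ht.trans e1) (iUnion_subset fun n => ?_)
  by_cases hn : N ≤ n
  · exact (hN n hn).trans e1
  · refine Subset.trans ?_ (ht'.trans e2)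
    exact subset_biUnion_of_mem (u := L) (show n ∈ {i | i < N} from not_le.1 hn)

lemma wslf_backward (X : Type*) [TopologicalSpace X] (V : Set (Set X))
    [FirstCountableTopology X] (M : Type) [TopologicalSpace M] [SecondCountableTopology M]
    (h : PLocallyFinite (KM M) V) : WeaklySigmaLF V := by
  classical
  obtain ⟨c, hmono, hlf, hc⟩ := h
  obtain ⟨W, hWo, hW⟩ := exists_W M
  refine ⟨fun n => {A | ∃ L : KM M, L.1 ⊆ W n ∧ A ∈ c L}, ?_, ?_⟩
  · rw [← hc]
    ext A
    simp only [mem_iUnion, mem_setOf_eq]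
    constructor
    · rintro ⟨n, L, _, hA⟩
      exact ⟨L, hA⟩
    · rintro ⟨L, hA⟩
      obtain ⟨n, hn, _⟩ := hW L.1 univ L.2 isOpen_univ (subset_univ _)
      exact ⟨n, L, hn, hA⟩
  · intro x A hA
    rw [← hc] at hA
    obtain ⟨K, hAK⟩ := mem_iUnion.1 hA
    by_contra hcon
    push Not at hcon
    obtain ⟨U, hU⟩ := (nhds x).exists_antitone_basis
    let G : ℕ → Set M := fun m => ⋂ i ∈ {i | i ≤ m ∧ K.1 ⊆ W i}, W i
    have hGo : ∀ m, IsOpen (G m) := fun m =>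
      ((Set.finite_le_nat m).subset fun i hi => hi.1).isOpen_biInter fun i _ => hWo i
    have hKG : ∀ m, K.1 ⊆ G m := fun m => subset_iInter₂ fun i hi => hi.2
    have hinf : ∀ m, {A | (∃ L : KM M, L.1 ⊆ G m ∧ A ∈ c L) ∧ (A ∩ U m).Nonempty}.Infinite := by
      intro m hfin
      obtain ⟨n, hn, hnG⟩ := hW K.1 (G m) K.2 (hGo m) (hKG m)
      refine hcon n ⟨K, hn, hAK⟩ ⟨U m, hU.1.mem_of_mem trivial, hfin.subset ?_⟩
      rintro B ⟨⟨L, hL, hB⟩, hBU⟩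
      exact ⟨⟨L, hL.trans hnG, hB⟩, hBU⟩
    obtain ⟨f, hf1, hf2⟩ := exists_seq_of_forall_finset_exists
      (fun p : ℕ × Set X => (∃ L : KM M, L.1 ⊆ G p.1 ∧ p.2 ∈ c L) ∧ (p.2 ∩ U p.1).Nonempty)
      (fun p q => p.1 < q.1 ∧ p.2 ≠ q.2) (by
        intro s _
        obtain ⟨B, hB, hBs⟩ := (hinf (s.sup Prod.fst + 1)).exists_notMem_finset (s.image Prod.snd)
        refine ⟨(s.sup Prod.fst + 1, B), hB, fun p hp => ⟨?_, ?_⟩⟩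
        · exact Nat.lt_succ_of_le (Finset.le_sup (f := Prod.fst) hp)
        · rintro rfl
          exact hBs (Finset.mem_image_of_mem _ hp))
    have hsm : StrictMono fun n => (f n).1 := fun m n hmn => (hf2 m n hmn).1
    have hinj : Function.Injective fun n => (f n).2 := by
      intro m n hmn
      rcases lt_trichotomy m n with h | h | h
      · exact absurd hmn (hf2 m n h).2
      · exact h
      · exact absurd hmn.symm (hf2 n m h).2
    choose L hL hfL using fun n => (hf1 n).1
    have hcomp : IsCompact (K.1 ∪ ⋃ n, (L n).1) := by
      refine compact_union_seq _ K.2 _ (fun n => (L n).2) ?_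
      intro O hO hKO
      obtain ⟨N, hN, hNO⟩ := hW _ O K.2 hO hKO
      refine ⟨N, fun n hn => (hL n).trans (Subset.trans ?_ hNO)⟩
      exact biInter_subset_of_mem (t := W) (show N ∈ {i | i ≤ (f n).1 ∧ K.1 ⊆ W i} from
        ⟨hn.trans (hsm.id_le n), hN⟩)
    obtain ⟨O, hO, hfin⟩ := hlf ⟨_, hcomp⟩ x
    obtain ⟨N, -, hN⟩ := hU.1.mem_iff.1 hO
    refine (infinite_of_injective_forall_mem (hinj.comp (add_left_injective N)) ?_) hfin
    intro n
    refine ⟨hmono (L (n + N)) _ ?_ (hfL (n + N)), ?_⟩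
    · exact (subset_iUnion (fun n => (L n).1) (n + N)).trans subset_union_right
    · refine (hf1 (n + N)).2.mono (inter_subset_inter_right _ ((hU.2 ?_).trans hN))
      exact (Nat.le_add_left N n).trans (hsm.id_le (n + N))

/-- A weakly σ-locally finite collection is `𝒦(M)`-locally finite for
some separable metrizable `M`; conversely, in a first countable space, any collection
which is `𝒦(M)`-locally finite for some separable metrizable `M` is weakly σ-locally
finite. -/
theorem statement7 (X : Type*) [TopologicalSpace X] (V : Set (Set X)) :
    (WeaklySigmaLF V →
      ∃ (M : Type) (_ : TopologicalSpace M), SeparableSpace M ∧ MetrizableSpace M ∧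
        PLocallyFinite (KM M) V) ∧
    (FirstCountableTopology X →
      (∃ (M : Type) (_ : TopologicalSpace M), SeparableSpace M ∧ MetrizableSpace M ∧
        PLocallyFinite (KM M) V) →
      WeaklySigmaLF V) := by
  refine ⟨wslf_forward X V, ?_⟩
  rintro hX ⟨M, tM, hs, hm, h⟩
  letI := metrizableSpaceMetric M
  haveI : SecondCountableTopology M := UniformSpace.secondCountable_of_separable M
  exact wslf_backward X V M h
end

section
/- A topological space X is 𝒦(M)-metrizable for some separable metrizable space M if and only if X has a weakly σ-locally finite base. -/
open Set TopologicalSpace Topology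

theorem LocallyFiniteAt.mono' {X : Type*} [TopologicalSpace X] {x : X} {C D : Set (Set X)}
    (h : LocallyFiniteAt x D) (hCD : C ⊆ D) : LocallyFiniteAt x C := by
  obtain ⟨U, hU, hf⟩ := h
  exact ⟨U, hU, hf.subset fun A hA => ⟨hCD hA.1, hA.2⟩⟩

theorem locallyFiniteAt_biUnion {X : Type*} [TopologicalSpace X] {x : X} (c : ℕ → Set (Set X))
    (F : Finset ℕ) (h : ∀ n ∈ F, LocallyFiniteAt x (c n)) :
    LocallyFiniteAt x (⋃ n ∈ F, c n) := by
  choose! U hU hf using h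
  refine ⟨⋂ n ∈ F, U n, (Filter.biInter_finset_mem F).2 hU, ?_⟩
  refine (Set.Finite.biUnion F.finite_toSet hf).subset ?_
  rintro A ⟨hA, y, hyA, hyU⟩
  simp only [mem_iUnion, mem_iInter] at hA hyU
  obtain ⟨n, hn, hAn⟩ := hA
  simp only [mem_iUnion]
  exact ⟨n, hn, hAn, y, hyA, hyU n hn⟩

theorem weak_imp_KM (X : Type*) [TopologicalSpace X] (B : Set (Set X)) (hB : IsBase B)
    (hw : WeaklySigmaLF B) :
    ∃ (M : Type) (_ : TopologicalSpace M), SeparableSpace M ∧ MetrizableSpace M ∧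
      PMetrizable (KM M) X := by
  classical
  obtain ⟨c, hc, hx⟩ := hw
  let S : Set (ℕ → Bool) := {T | ∀ x : X, ∃ n, T n = true ∧ LocallyFiniteAt x (c n)}
  let T : Set X → (ℕ → Bool) := fun A n => decide (A ∈ c n)
  refine ⟨S, inferInstance, inferInstance, inferInstance, B, hB, ?_⟩
  refine ⟨fun p => {A | A ∈ B ∧ ∃ t ∈ p.1.1, t.1 = T A}, ?_, ?_, ?_⟩
  · rintro p p' hp A ⟨hA, t, ht, h⟩
    exact ⟨hA, t, hp.1 ht, h⟩
  · rintro ⟨⟨K, hK⟩, m⟩ x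
    let O : {n // LocallyFiniteAt x (c n)} → Set S := fun n => {t | t.1 n.1 = true}
    have hO : ∀ n, IsOpen (O n) := fun n => by
      have hcont : Continuous (fun t : S => t.1 n.1) :=
        (continuous_apply n.1).comp continuous_subtype_val
      exact (isOpen_discrete ({true} : Set Bool)).preimage hcont
    obtain ⟨F, hF⟩ := hK.elim_finite_subcover O hO (by
      intro t _
      obtain ⟨n, hn, hl⟩ := t.2 x
      exact mem_iUnion.2 ⟨⟨n, hl⟩, hn⟩)
    refine (locallyFiniteAt_biUnion c (F.image Subtype.val) ?_).mono' ?_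
    · intro n hn
      obtain ⟨k, _, rfl⟩ := Finset.mem_image.1 hn
      exact k.2
    · rintro A ⟨hA, t, ht, h⟩
      have h2 := hF ht
      simp only [mem_iUnion] at h2
      obtain ⟨n, hn, hnt⟩ := h2
      simp only [mem_iUnion]
      refine ⟨n.1, Finset.mem_image_of_mem _ hn, ?_⟩
      have h3 : t.1 n.1 = true := hnt
      rw [h] at h3
      exact of_decide_eq_true h3
  · ext A
    simp only [mem_iUnion]
    constructor
    · rintro ⟨p, hA, _⟩
      exact hA
    · intro hA
      refine ⟨⟨⟨{⟨T A, ?_⟩}, isCompact_singleton⟩, 0⟩, hA, _, rfl, rfl⟩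
      intro x
      obtain ⟨n, hn, hl⟩ := hx x A hA
      exact ⟨n, decide_eq_true hn, hl⟩

theorem isCompact_union_seq {M : Type*} [PseudoMetricSpace M] {K : Set M} (hK : IsCompact K)
    (L : ℕ → Set M) (hL : ∀ k, IsCompact (L k)) (k : ℕ → ℕ) (hk : ∀ i, i ≤ k i)
    (hLK : ∀ i, L i ⊆ Metric.thickening (1 / ((k i : ℝ) + 1)) K) :
    IsCompact (K ∪ ⋃ i, L i) := by
  classical
  apply isCompact_of_finite_subcover
  intro ι U hU hcov
  obtain ⟨F, hF⟩ := hK.elim_finite_subcover U hU (subset_union_left.trans hcov)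
  have hOo : IsOpen (⋃ i ∈ F, U i) := isOpen_biUnion fun i _ => hU i
  obtain ⟨δ, hδ, hsub⟩ := hK.exists_thickening_subset_open hOo hF
  obtain ⟨N, hN⟩ := exists_nat_one_div_lt hδ
  have hfin : IsCompact (⋃ i ∈ Finset.range N, L i) :=
    (Finset.range N).isCompact_biUnion fun i _ => hL i
  obtain ⟨G, hG⟩ := hfin.elim_finite_subcover U hU (by
    refine Subset.trans ?_ (subset_union_right.trans hcov)
    exact iUnion₂_subset fun i _ => subset_iUnion L i)
  refine ⟨F ∪ G, ?_⟩
  have hFU : (⋃ i ∈ F, U i) ⊆ ⋃ i ∈ F ∪ G, U i :=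
    biUnion_subset_biUnion_left fun i hi => Finset.mem_union_left _ hi
  have hGU : (⋃ i ∈ G, U i) ⊆ ⋃ i ∈ F ∪ G, U i :=
    biUnion_subset_biUnion_left fun i hi => Finset.mem_union_right _ hi
  refine union_subset (hF.trans hFU) (iUnion_subset fun i => ?_)
  by_cases hi : i < N
  · refine Subset.trans ?_ (hG.trans hGU)
    exact subset_biUnion_of_mem (u := L) (Finset.mem_range.2 hi)
  · refine (hLK i).trans (Subset.trans (Metric.thickening_mono ?_ K) (hsub.trans hFU))
    refine le_trans ?_ hN.le
    apply one_div_le_one_div_of_le (by positivity)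
    have : N ≤ k i := (not_lt.1 hi).trans (hk i)
    have : (N : ℝ) ≤ k i := by exact_mod_cast this
    linarith

theorem exists_finset_basis_between {M : Type*} [TopologicalSpace M] [SecondCountableTopology M]
    {K O : Set M} (hK : IsCompact K) (hO : IsOpen O) (hKO : K ⊆ O) :
    ∃ e : Finset (countableBasis M), K ⊆ (⋃ b ∈ e, (b : Set M)) ∧ (⋃ b ∈ e, (b : Set M)) ⊆ O := by
  classical
  let ι := {b : countableBasis M // (b : Set M) ⊆ O}
  obtain ⟨F, hF⟩ := hK.elim_finite_subcover (fun b : ι => (b.1 : Set M))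
    (fun b => isOpen_of_mem_countableBasis b.1.2) (by
      intro y hy
      obtain ⟨b, hb, hyb, hbO⟩ := (isBasis_countableBasis M).exists_subset_of_mem_open (hKO hy) hO
      exact mem_iUnion.2 ⟨⟨⟨b, hb⟩, hbO⟩, hyb⟩)
  refine ⟨F.image Subtype.val, ?_, ?_⟩
  · intro y hy
    have := hF hy
    simp only [mem_iUnion] at this ⊢
    obtain ⟨b, hb, hyb⟩ := this
    exact ⟨b.1, Finset.mem_image_of_mem _ hb, hyb⟩
  · refine iUnion₂_subset fun b hb => ?_
    obtain ⟨b', _, rfl⟩ := Finset.mem_image.1 hb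
    exact b'.2

/-- All members of levels `(L, n)` with `L` inside the finite union of basic sets `e`. -/
def levelD {M : Type*} [TopologicalSpace M] [SecondCountableTopology M] {X : Type*}
    (c : KM M × ℕ → Set (Set X)) (e : Finset (countableBasis M)) (n : ℕ) : Set (Set X) :=
  {A | ∃ L : KM M, L.1 ⊆ (⋃ b ∈ e, (b : Set M)) ∧ A ∈ c (L, n)}

theorem key_level {M : Type*} [PseudoMetricSpace M] [SecondCountableTopology M] {X : Type*}
    (c : KM M × ℕ → Set (Set X)) (hmono : ∀ p p', p ≤ p' → c p ⊆ c p')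
    (V : ℕ → Set X) (hV : Antitone V)
    (hfin : ∀ p, ∃ k, {A ∈ c p | (A ∩ V k).Nonempty}.Finite) (K : KM M) (n : ℕ) :
    ∃ e : Finset (countableBasis M), K.1 ⊆ (⋃ b ∈ e, (b : Set M)) ∧
      ∃ k, {A ∈ levelD c e n | (A ∩ V k).Nonempty}.Finite := by
  classical
  by_contra! hcon
  have h1 : ∀ k : ℕ, ∃ e : Finset (countableBasis M), K.1 ⊆ (⋃ b ∈ e, (b : Set M)) ∧
      (⋃ b ∈ e, (b : Set M)) ⊆ Metric.thickening (1 / ((k : ℝ) + 1)) K.1 := fun k =>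
    exists_finset_basis_between K.2 Metric.isOpen_thickening
      (Metric.self_subset_thickening (by positivity) _)
  choose e heK he using h1
  obtain ⟨f, hfP, hfr⟩ := exists_seq_of_forall_finset_exists
    (fun q : ℕ × Set X => q.2 ∈ levelD c (e q.1) n ∧ (q.2 ∩ V q.1).Nonempty)
    (fun q q' => q.1 < q'.1 ∧ q.2 ≠ q'.2) (by
      intro s _
      obtain ⟨A, hA, hAs⟩ := (show Set.Infinite _ from
        hcon (e (s.sup Prod.fst + 1)) (heK _) (s.sup Prod.fst + 1)).exists_notMem_finset
          (s.image Prod.snd)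
      refine ⟨(s.sup Prod.fst + 1, A), hA, fun q hq => ⟨?_, ?_⟩⟩
      · exact Nat.lt_succ_of_le (Finset.le_sup (f := Prod.fst) hq)
      · rintro rfl
        exact hAs (Finset.mem_image_of_mem _ hq))
  have hsm : StrictMono fun i => (f i).1 := fun i j hij => (hfr i j hij).1
  have hinj : Function.Injective fun i => (f i).2 := by
    intro i j hij
    by_contra hne
    rcases lt_or_gt_of_ne hne with h | h
    · exact (hfr i j h).2 hij
    · exact (hfr j i h).2 hij.symm
  have hL : ∀ i, ∃ L : KM M, L.1 ⊆ (⋃ b ∈ e (f i).1, (b : Set M)) ∧ (f i).2 ∈ c (L, n) :=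
    fun i => (hfP i).1
  choose L hLe hLc using hL
  have hcomp : IsCompact (K.1 ∪ ⋃ i, (L i).1) :=
    isCompact_union_seq K.2 (fun i => (L i).1) (fun i => (L i).2) (fun i => (f i).1)
      (fun i => hsm.le_apply) (fun i => (hLe i).trans (he _))
  obtain ⟨k, hk⟩ := hfin (⟨_, hcomp⟩, n)
  have hinf : (((fun i => (f i).2) '' Ici k)).Infinite :=
    (Set.Ici_infinite k).image hinj.injOn
  refine hinf (hk.subset ?_)
  rintro _ ⟨i, hi, rfl⟩
  refine ⟨hmono (L i, n) (⟨_, hcomp⟩, n) ⟨?_, le_rfl⟩ (hLc i), ?_⟩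
  · exact (subset_iUnion (fun i => (L i).1) i).trans subset_union_right
  · obtain ⟨y, hy1, hy2⟩ := (hfP i).2
    exact ⟨y, hy1, hV ((show k ≤ i from hi).trans hsm.le_apply) hy2⟩

theorem KM_imp_weak (X : Type*) [TopologicalSpace X] (M : Type) [PseudoMetricSpace M]
    [SecondCountableTopology M] (B : Set (Set X)) (hB : IsBase B)
    (h : PLocallyFinite (KM M × ℕ) B) : WeaklySigmaLF B := by
  classical
  obtain ⟨c, hmono, hlf, hun⟩ := h
  have hcB : ∀ p, c p ⊆ B := fun p => hun ▸ subset_iUnion c p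
  have hmem : ∀ A ∈ B, ∃ p, A ∈ c p := fun A hA => by
    rw [← hun] at hA
    exact mem_iUnion.1 hA
  have hDB : ∀ e n, levelD c e n ⊆ B := by
    rintro e n A ⟨L, _, hA⟩
    exact hcB _ hA
  -- point-countability
  have hcount : ∀ x : X, {A ∈ B | x ∈ A}.Countable := by
    intro x
    let I : Set (Finset (countableBasis M) × ℕ) := {q | {A ∈ levelD c q.1 q.2 | x ∈ A}.Finite}
    have hc2 : (⋃ q ∈ I, {A ∈ levelD c q.1 q.2 | x ∈ A}).Countable :=
      (Set.to_countable I).biUnion fun q hq => Set.Finite.countable hq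
    refine hc2.mono ?_
    rintro A ⟨hA, hxA⟩
    obtain ⟨⟨K, n⟩, hAK⟩ := hmem A hA
    obtain ⟨e, hKe, k, hfin⟩ := key_level c hmono (fun _ => {x}) (fun _ _ _ => le_rfl) (by
      intro p
      obtain ⟨U, hU, hf⟩ := hlf p x
      refine ⟨0, hf.subset ?_⟩
      rintro A ⟨hA, y, hy, rfl⟩
      exact ⟨hA, y, hy, mem_of_mem_nhds hU⟩) K n
    refine mem_biUnion (x := (e, n)) ?_ ⟨⟨K, hKe, hAK⟩, hxA⟩
    exact hfin.subset fun A hA => ⟨hA.1, x, hA.2, rfl⟩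
  have hfc : ∀ x : X, (nhds x).IsCountablyGenerated := by
    intro x
    have hb : (nhds x).HasBasis (fun A => A ∈ {A ∈ B | x ∈ A}) id := by
      refine ⟨fun U => ⟨fun hU => ?_, ?_⟩⟩
      · obtain ⟨W, hWU, hW, hxW⟩ := mem_nhds_iff.1 hU
        obtain ⟨b, hb, hxb, hbW⟩ := hB.2 W hW x hxW
        exact ⟨b, ⟨hb, hxb⟩, hbW.trans hWU⟩
      · rintro ⟨b, ⟨hb, hxb⟩, hbU⟩
        exact Filter.mem_of_superset ((hB.1 b hb).mem_nhds hxb) hbU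
    exact (Filter.HasCountableBasis.mk hb (hcount x)).isCountablyGenerated
  obtain ⟨g, hg⟩ := exists_surjective_nat (Finset (countableBasis M) × ℕ)
  refine ⟨fun i => levelD c (g i).1 (g i).2, ?_, ?_⟩
  · refine Subset.antisymm (iUnion_subset fun i => hDB _ _) fun A hA => ?_
    obtain ⟨⟨K, n⟩, hAK⟩ := hmem A hA
    obtain ⟨e, hKe, _⟩ := exists_finset_basis_between K.2 isOpen_univ (subset_univ _)
    obtain ⟨i, hi⟩ := hg (e, n)
    refine mem_iUnion.2 ⟨i, ?_⟩
    rw [hi]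
    exact ⟨K, hKe, hAK⟩
  · intro x A hA
    obtain ⟨⟨K, n⟩, hAK⟩ := hmem A hA
    haveI := hfc x
    obtain ⟨V, hV⟩ := (nhds x).exists_antitone_basis
    obtain ⟨e, hKe, k, hfin⟩ := key_level c hmono V hV.antitone (by
      intro p
      obtain ⟨U, hU, hf⟩ := hlf p x
      obtain ⟨k, hk⟩ := hV.mem_iff.1 hU
      refine ⟨k, hf.subset ?_⟩
      rintro A ⟨hA, y, hy, hyV⟩
      exact ⟨hA, y, hy, hk hyV⟩) K n
    obtain ⟨i, hi⟩ := hg (e, n)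
    refine ⟨i, ?_, V k, hV.mem k, ?_⟩
    · simp only [hi]
      exact ⟨K, hKe, hAK⟩
    · simp only [hi]
      exact hfin

/-- A space `X` is `𝒦(M)`-metrizable for some separable metrizable `M`
if and only if `X` has a weakly σ-locally finite base. -/
theorem statement8 (X : Type*) [TopologicalSpace X] :
    (∃ (M : Type) (_ : TopologicalSpace M), SeparableSpace M ∧ MetrizableSpace M ∧
      PMetrizable (KM M) X) ↔
    ∃ B : Set (Set X), IsBase B ∧ WeaklySigmaLF B := by
  constructor
  · rintro ⟨M, _, hs, hm, B, hB, h⟩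
    letI : MetricSpace M := metrizableSpaceMetric M
    haveI : SecondCountableTopology M := UniformSpace.secondCountable_of_separable M
    exact ⟨B, hB, KM_imp_weak X M B hB h⟩
  · rintro ⟨B, hB, hw⟩
    exact weak_imp_KM X B hB hw
end

section
/- If a topological space X is 𝒦(M)-metrizable for some separable metrizable space M, then X has a σ-relatively locally finite base. -/
open Set TopologicalSpace Topology

theorem aux_compact {M : Type} [MetricSpace M] (K : Set M) (hK : IsCompact K)
    (L : ℕ → Set M) (hL : ∀ n, IsCompact (L n))
    (hsub : ∀ n, L n ⊆ Metric.thickening (1 / ((n : ℝ) + 1)) K) :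
    IsCompact (K ∪ ⋃ n, L n) := by
  classical
  refine isCompact_of_finite_subcover ?_
  intro ι W hWo hW
  obtain ⟨t0, ht0⟩ := hK.elim_finite_subcover W hWo (subset_union_left.trans hW)
  obtain ⟨δ, hδ, hth⟩ := hK.exists_thickening_subset_open
    (isOpen_biUnion (fun i (_ : i ∈ t0) => hWo i)) ht0
  obtain ⟨N, hN⟩ := exists_nat_one_div_lt hδ
  have hc : IsCompact (⋃ n ∈ Finset.range N, L n) :=
    (Finset.range N).isCompact_biUnion (fun n _ => hL n)
  obtain ⟨t1, ht1⟩ := hc.elim_finite_subcover W hWo (by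
    refine Subset.trans ?_ hW
    intro y hy
    simp only [mem_iUnion] at hy
    obtain ⟨n, _, hy⟩ := hy
    exact Or.inr (mem_iUnion.2 ⟨n, hy⟩))
  refine ⟨t0 ∪ t1, ?_⟩
  rw [Finset.set_biUnion_union]
  rintro y (hy | hy)
  · exact Or.inl (ht0 hy)
  · obtain ⟨n, hy⟩ := mem_iUnion.1 hy
    by_cases hn : n < N
    · refine Or.inr (ht1 ?_)
      simp only [mem_iUnion]
      exact ⟨n, Finset.mem_range.2 hn, hy⟩
    · refine Or.inl (hth (Metric.thickening_mono ?_ K (hsub n hy)))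
      refine le_trans ?_ hN.le
      have : (N : ℝ) ≤ n := by exact_mod_cast not_lt.1 hn
      gcongr

theorem aux_codes (M : Type) [TopologicalSpace M] [SecondCountableTopology M] :
    ∃ O : Set (Set M), O.Countable ∧ O.Nonempty ∧
      ∀ K U : Set M, IsCompact K → IsOpen U → K ⊆ U → ∃ V ∈ O, K ⊆ V ∧ V ⊆ U := by
  classical
  refine ⟨(fun F : Set (Set M) => ⋃₀ F) '' {F | F.Finite ∧ F ⊆ countableBasis M},
    (countable_setOf_finite_subset (countable_countableBasis M)).image _,
    ⟨_, ∅, ⟨finite_empty, empty_subset _⟩, rfl⟩, ?_⟩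
  intro K U hK hU hKU
  obtain ⟨t, ht, htf, htK⟩ := hK.elim_finite_subcover_image
    (b := {V | V ∈ countableBasis M ∧ V ⊆ U}) (c := id)
    (fun V hV => isOpen_of_mem_countableBasis hV.1) (by
      intro y hy
      obtain ⟨V, hV, hyV, hVU⟩ :=
        (isBasis_countableBasis M).exists_subset_of_mem_open (hKU hy) hU
      exact mem_biUnion (show V ∈ {V | V ∈ countableBasis M ∧ V ⊆ U} from ⟨hV, hVU⟩) hyV)
  refine ⟨_, ⟨t, ⟨htf, fun V hV => (ht hV).1⟩, rfl⟩, ?_, ?_⟩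
  · simpa [sUnion_eq_biUnion] using htK
  · exact sUnion_subset fun V hV => (ht hV).2

theorem aux_key {X : Type*} {M : Type} [MetricSpace M]
    (O : Set (Set M))
    (hO : ∀ K U : Set M, IsCompact K → IsOpen U → K ⊆ U → ∃ V ∈ O, K ⊆ V ∧ V ⊆ U)
    (B : Set (Set X)) (c : KM M × ℕ → Set (Set X))
    (hmono : ∀ p p' : KM M × ℕ, p ≤ p' → c p ⊆ c p')
    (q : Set X → KM M × ℕ) (hq : ∀ A ∈ B, A ∈ c (q A))
    (U : ℕ → Set X) (hU : Antitone U)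
    (hfin : ∀ p, ∃ n, {A ∈ c p | (A ∩ U n).Nonempty}.Finite)
    (p : KM M × ℕ) :
    ∃ V ∈ O, p.1.1 ⊆ V ∧
      ∃ n, {A ∈ {A ∈ B | (q A).1.1 ⊆ V ∧ (q A).2 = p.2} | (A ∩ U n).Nonempty}.Finite := by
  classical
  by_contra hcon
  push Not at hcon
  have hV : ∀ n : ℕ, ∃ V ∈ O, p.1.1 ⊆ V ∧ V ⊆ Metric.thickening (1 / ((n : ℝ) + 1)) p.1.1 :=
    fun n => hO _ _ p.1.2 Metric.isOpen_thickening
      (Metric.self_subset_thickening (by positivity) _)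
  choose V hVO hKV hVt using hV
  obtain ⟨f, hf1, hf2⟩ := exists_seq_of_forall_finset_exists
    (fun z : ℕ × Set X => z.2 ∈ {A ∈ {A ∈ B | (q A).1.1 ⊆ V z.1 ∧ (q A).2 = p.2} |
      (A ∩ U z.1).Nonempty})
    (fun z w => z.1 < w.1 ∧ z.2 ≠ w.2) (by
      intro s _
      have hinf := hcon (V (s.sup Prod.fst + 1)) (hVO _) (hKV _) (s.sup Prod.fst + 1)
      obtain ⟨A, hA, hAs⟩ := Set.Infinite.exists_notMem_finset hinf (s.image Prod.snd)
      refine ⟨(s.sup Prod.fst + 1, A), hA, fun z hz => ⟨?_, ?_⟩⟩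
      · exact Nat.lt_succ_of_le (Finset.le_sup (f := Prod.fst) hz)
      · rintro rfl
        exact hAs (Finset.mem_image_of_mem _ hz))
  have hsm : StrictMono (fun n => (f n).1) := fun m n hmn => (hf2 m n hmn).1
  have hge : ∀ n, n ≤ (f n).1 := fun n => hsm.le_apply
  have hinj : Function.Injective (fun n => (f n).2) := by
    intro m n hmn
    rcases lt_trichotomy m n with h | h | h
    · exact absurd hmn (hf2 m n h).2
    · exact h
    · exact absurd hmn.symm (hf2 n m h).2
  have hcomp := aux_compact p.1.1 p.1.2 (fun n => (q (f n).2).1.1) (fun n => (q (f n).2).1.2)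
    (fun n => by
      refine ((hf1 n).1.2.1.trans (hVt _)).trans (Metric.thickening_mono ?_ _)
      have : (n : ℝ) ≤ (f n).1 := by exact_mod_cast hge n
      gcongr)
  obtain ⟨N, hN⟩ := hfin (⟨_, hcomp⟩, p.2)
  have hsub : (fun n => (f n).2) '' Ici N ⊆ {A ∈ c (⟨_, hcomp⟩, p.2) | (A ∩ U N).Nonempty} := by
    rintro _ ⟨n, hn, rfl⟩
    refine ⟨hmono _ _ ?_ (hq _ (hf1 n).1.1), ?_⟩
    · refine ⟨?_, (hf1 n).1.2.2.le⟩
      show (q (f n).2).1.1 ⊆ _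
      exact fun y hy => Or.inr (mem_iUnion.2 ⟨n, hy⟩)
    · exact (hf1 n).2.mono (inter_subset_inter_right _ (hU (le_trans hn (hge n))))
  exact ((Set.Ici_infinite N).image hinj.injOn) (hN.subset hsub)

/-- If `X` is `𝒦(M)`-metrizable for some separable metrizable `M`,
then `X` has a σ-relatively locally finite base. -/
theorem statement9 (X : Type*) [TopologicalSpace X]
    (h : ∃ (M : Type) (_ : TopologicalSpace M), SeparableSpace M ∧ MetrizableSpace M ∧
      PMetrizable (KM M) X) :
    ∃ B : Set (Set X), IsBase B ∧ SigmaRelLF B := by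
  classical
  obtain ⟨M, tM, hsep, hmet, B, hB, c, hmono, hlf, hc⟩ := h
  letI : MetricSpace M := metrizableSpaceMetric M
  haveI : SecondCountableTopology M := UniformSpace.secondCountable_of_separable M
  obtain ⟨O, hOc, hOne, hO⟩ := aux_codes M
  have hq : ∀ A : Set X, ∃ p : KM M × ℕ, A ∈ B → A ∈ c p := by
    intro A
    by_cases hA : A ∈ B
    · rw [← hc] at hA
      obtain ⟨p, hp⟩ := mem_iUnion.1 hA
      exact ⟨p, fun _ => hp⟩
    · exact ⟨(⟨∅, isCompact_empty⟩, 0), fun h => absurd h hA⟩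
  choose q hq using hq
  have hctb : ∀ x : X, {A | A ∈ B ∧ x ∈ A}.Countable := by
    intro x
    have h1 := aux_key O hO B c hmono q hq (fun _ => {x}) (fun _ _ _ => le_rfl) (by
      intro p
      obtain ⟨U, hU, hf⟩ := hlf p x
      refine ⟨0, hf.subset fun A hA => ⟨hA.1, hA.2.mono ?_⟩⟩
      exact inter_subset_inter_right _ (singleton_subset_iff.2 (mem_of_mem_nhds hU)))
    let S : Set M × ℕ → Set (Set X) := fun z =>
      {A ∈ {A ∈ B | (q A).1.1 ⊆ z.1 ∧ (q A).2 = z.2} | (A ∩ {x}).Nonempty}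
    have h2 : {A | A ∈ B ∧ x ∈ A} ⊆ ⋃ z ∈ {z : Set M × ℕ | z ∈ O ×ˢ univ ∧ (S z).Finite}, S z := by
      rintro A ⟨hA, hxA⟩
      obtain ⟨V, hV, hAV, n, hf⟩ := h1 (q A)
      exact mem_biUnion (x := (V, (q A).2)) ⟨⟨hV, mem_univ _⟩, hf⟩
        ⟨⟨hA, hAV, rfl⟩, ⟨x, hxA, rfl⟩⟩
    refine Countable.mono h2 (Countable.biUnion ?_ fun z hz => hz.2.countable)
    exact (hOc.prod countable_univ).mono fun z hz => hz.1
  have hcg : ∀ x : X, (𝓝 x).IsCountablyGenerated := by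
    intro x
    have hb : (𝓝 x).HasBasis (fun A : Set X => A ∈ B ∧ x ∈ A) id := by
      constructor
      intro t
      constructor
      · intro ht
        obtain ⟨u, hut, huo, hxu⟩ := mem_nhds_iff.1 ht
        obtain ⟨b, hb, hxb, hbu⟩ := hB.2 u huo x hxu
        exact ⟨b, ⟨hb, hxb⟩, hbu.trans hut⟩
      · rintro ⟨b, ⟨hb, hxb⟩, hbt⟩
        exact Filter.mem_of_superset ((hB.1 b hb).mem_nhds hxb) hbt
    exact Filter.HasCountableBasis.isCountablyGenerated ⟨hb, hctb x⟩
  let C : Set M × ℕ → Set (Set X) := fun z => {A ∈ B | (q A).1.1 ⊆ z.1 ∧ (q A).2 = z.2}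
  have hweak : ∀ x : X, ∀ A ∈ B, ∃ z ∈ O ×ˢ (univ : Set ℕ), A ∈ C z ∧ LocallyFiniteAt x (C z) := by
    intro x A hA
    haveI := hcg x
    obtain ⟨U, hU⟩ := (𝓝 x).exists_antitone_basis
    obtain ⟨V, hV, hAV, n, hf⟩ := aux_key O hO B c hmono q hq U hU.antitone (by
      intro p
      obtain ⟨W, hW, hf⟩ := hlf p x
      obtain ⟨n, hn⟩ := hU.mem_iff.1 hW
      exact ⟨n, hf.subset fun A hA => ⟨hA.1, hA.2.mono (inter_subset_inter_right _ hn)⟩⟩) (q A)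
    exact ⟨(V, (q A).2), ⟨hV, mem_univ _⟩, ⟨hA, hAV, rfl⟩, U n, hU.mem n, hf⟩
  obtain ⟨e, he⟩ := (hOc.prod (countable_univ (α := ℕ))).exists_eq_range
    (hOne.prod univ_nonempty)
  let W : ℕ → Set X := fun n => {x | LocallyFiniteAt x (C (e n))}
  have hWo : ∀ n, IsOpen (W n) := by
    intro n
    rw [isOpen_iff_mem_nhds]
    rintro x ⟨U, hU, hf⟩
    filter_upwards [eventually_mem_nhds_iff.2 hU] with y hy
    exact ⟨U, hy, hf⟩
  let D : ℕ → Set (Set X) := fun n => (fun A => A ∩ W n) '' C (e n)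
  refine ⟨⋃ n, D n, ⟨?_, ?_⟩, D, rfl, ?_⟩
  · intro b hb
    obtain ⟨n, A, hA, rfl⟩ := mem_iUnion.1 hb
    exact (hB.1 A hA.1).inter (hWo n)
  · intro U hU x hx
    obtain ⟨b, hb, hxb, hbU⟩ := hB.2 U hU x hx
    obtain ⟨z, hz, hbz, hl⟩ := hweak x b hb
    rw [he] at hz
    obtain ⟨n, rfl⟩ := hz
    exact ⟨b ∩ W n, mem_iUnion.2 ⟨n, b, hbz, rfl⟩, ⟨hxb, hl⟩, inter_subset_left.trans hbU⟩
  · rintro n x ⟨_, ⟨A, hA, rfl⟩, hxA⟩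
    obtain ⟨U, hU, hf⟩ := hxA.2
    refine ⟨U, hU, (hf.image (fun A => A ∩ W n)).subset ?_⟩
    rintro _ ⟨⟨A', hA', rfl⟩, hne⟩
    exact ⟨A', ⟨hA', hne.mono (inter_subset_inter_left _ inter_subset_left)⟩, rfl⟩
end

section
/- Let P be a directed set. If X is a Moore space which is P-paracompact, then X is P-metrizable. -/
open Set TopologicalSpace Topology

/-- A `P`-paracompact Moore space (regular Hausdorff with a development)
is `P`-metrizable, for any directed set `P`. -/
theorem statement13 (P : Type*) [PartialOrder P] (hdir : DirectedPoset P)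
    (X : Type*) [TopologicalSpace X] [T2Space X] [RegularSpace X]
    (hmoore : HasDevelopment X)
    (hpp : PParacompact P X) :
    PMetrizable P X := by
  obtain ⟨G, hG, hdev⟩ := hmoore
  choose V hV href c hmono hlf hc using fun n => hpp (G n) (hG n)
  refine ⟨⋃ n, V n, ⟨?_, ?_⟩, fun q => ⋃ i ∈ Set.Iic q.2, c i q.1, ?_, ?_, ?_⟩
  · intro b hb
    obtain ⟨n, hn⟩ := mem_iUnion.1 hb
    exact (hV n).1 b hn
  · intro U hU x hx
    obtain ⟨n, hn⟩ := hdev x U hU hx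
    have hxV : x ∈ ⋃₀ V n := by rw [(hV n).2]; trivial
    obtain ⟨W, hW, hxW⟩ := hxV
    obtain ⟨W', hW', hWW⟩ := href n W hW
    exact ⟨W, mem_iUnion.2 ⟨n, hW⟩, hxW,
      fun y hy => hn ⟨W', ⟨hW', hWW hxW⟩, hWW hy⟩⟩
  · intro q q' hq A hA
    simp only [mem_iUnion, mem_Iic] at hA ⊢
    obtain ⟨i, hi, hA⟩ := hA
    exact ⟨i, hi.trans hq.2, hmono i _ _ hq.1 hA⟩
  · intro q x
    choose U hU hfin using fun i => hlf i q.1 x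
    refine ⟨⋂ i ∈ Set.Iic q.2, U i,
      (Filter.biInter_mem (Set.finite_Iic q.2)).2 (fun i _ => hU i), ?_⟩
    refine ((Set.finite_Iic q.2).biUnion (fun i _ => hfin i)).subset ?_
    rintro A ⟨hA, y, hyA, hyU⟩
    simp only [mem_iUnion] at hA
    obtain ⟨i, hi, hA⟩ := hA
    exact mem_biUnion hi ⟨hA, y, hyA, mem_iInter₂.1 hyU i hi⟩
  · ext A
    simp only [mem_iUnion, mem_Iic, ← hc]
    constructor
    · rintro ⟨q, i, -, hA⟩
      exact ⟨i, q.1, hA⟩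
    · rintro ⟨i, p, hA⟩
      exact ⟨(p, i), i, le_rfl, hA⟩
end

section
/- Let X be a ccc Tychonoff space. If X is first countable and 𝒦(𝓜)-paracompact, then X is Lindelöf. -/
open Set TopologicalSpace Topology

lemma aux_compact_s16 {M : Type*} [TopologicalSpace M] {K : Set M} (hK : IsCompact K)
    (F : ℕ → Set M) (hF : ∀ n, IsCompact (F n))
    (h : ∀ O, IsOpen O → K ⊆ O → ∃ N, ∀ n, N ≤ n → F n ⊆ O) :
    IsCompact (K ∪ ⋃ n, F n) := by
  classical
  apply isCompact_of_finite_subcover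
  intro ι U hU hcov
  obtain ⟨t0, ht0⟩ := hK.elim_finite_subcover U hU (subset_union_left.trans hcov)
  obtain ⟨N, hN⟩ := h _ (isOpen_biUnion fun i _ => hU i) ht0
  have hc : IsCompact (⋃ n ∈ Finset.range N, F n) :=
    (Finset.range N).isCompact_biUnion fun n _ => hF n
  obtain ⟨t1, ht1⟩ := hc.elim_finite_subcover U hU (by
    refine Subset.trans ?_ (subset_union_right.trans hcov)
    exact iUnion₂_subset fun n _ => subset_iUnion F n)
  refine ⟨t0 ∪ t1, ?_⟩
  rw [Finset.set_biUnion_union]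
  refine union_subset (ht0.trans subset_union_left) (iUnion_subset fun n => ?_)
  by_cases hn : N ≤ n
  · exact (hN n hn).trans subset_union_left
  · refine Subset.trans ?_ (ht1.trans subset_union_right)
    exact subset_biUnion_of_mem (u := F) (Finset.mem_coe.2 (Finset.mem_range.2 (not_le.1 hn)))

lemma aux_basis {M : Type*} [TopologicalSpace M] [SecondCountableTopology M] :
    ∃ 𝓦 : Set (Set M), 𝓦.Countable ∧ ∀ K : Set M, IsCompact K → ∀ O, IsOpen O → K ⊆ O →
      ∃ W ∈ 𝓦, K ⊆ W ∧ W ⊆ O := by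
  classical
  refine ⟨sUnion '' {s | s.Finite ∧ s ⊆ countableBasis M},
    (Set.countable_ofPred_finite_subset (countable_countableBasis M)).image _, ?_⟩
  intro K hK O hO hKO
  have hb := isBasis_countableBasis M
  let S : Set (Set M) := {b ∈ countableBasis M | b ⊆ O}
  obtain ⟨t, htS, htf, hcov⟩ := hK.elim_finite_subcover_image (b := S) (c := id)
    (fun b hb' => hb.isOpen hb'.1) (by
      intro x hx
      obtain ⟨b, hb1, hxb, hbO⟩ := hb.exists_subset_of_mem_open (hKO hx) hO
      exact mem_biUnion (show b ∈ S from ⟨hb1, hbO⟩) hxb)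
  refine ⟨⋃₀ t, ⟨t, ⟨htf, fun b hb => (htS hb).1⟩, rfl⟩, ?_, ?_⟩
  · rwa [sUnion_eq_biUnion]
  · exact sUnion_subset fun b hb => (htS hb).2

lemma aux_ccc {X : Type*} [TopologicalSpace X] (hccc : CCC X) (c : Set (Set X))
    (hc : ∀ A ∈ c, IsOpen A) :
    {A ∈ c | ∃ x ∈ A, LocallyFiniteAt x c}.Countable := by
  let G : Set (Set X) := {W | IsOpen W ∧ W.Nonempty ∧ {A ∈ c | (A ∩ W).Nonempty}.Finite}
  obtain ⟨D, hD⟩ : ∃ D, Maximal (fun D => D ∈ {D : Set (Set X) | D ⊆ G ∧ D.Pairwise Disjoint}) D := by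
    refine zorn_subset _ ?_
    intro C hC hch
    refine ⟨⋃₀ C, ⟨sUnion_subset fun s hs => (hC hs).1, ?_⟩, fun s hs => subset_sUnion_of_mem hs⟩
    exact (pairwise_sUnion hch.directedOn).2 fun s hs => (hC hs).2
  have hDc : D.Countable := hccc D (fun U hU => ⟨(hD.prop.1 hU).1, (hD.prop.1 hU).2.1⟩) hD.prop.2
  refine (hDc.biUnion (t := fun W _ => {A ∈ c | (A ∩ W).Nonempty})
    fun W hW => (hD.prop.1 hW).2.2.countable).mono ?_
  rintro A ⟨hA, x, hxA, N, hN, hfin⟩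
  by_contra hcon
  have hdis : ∀ W ∈ D, ¬ (A ∩ W).Nonempty := by
    intro W hW hne
    exact hcon (mem_biUnion hW ⟨hA, hne⟩)
  obtain ⟨N', hN'N, hN'o, hxN'⟩ := mem_nhds_iff.1 hN
  have hWG : A ∩ N' ∈ G := by
    refine ⟨(hc A hA).inter hN'o, ⟨x, hxA, hxN'⟩, hfin.subset ?_⟩
    rintro B ⟨hB, y, hyB, -, hyN⟩
    exact ⟨hB, y, hyB, hN'N hyN⟩
  have hins : insert (A ∩ N') D ∈ {D : Set (Set X) | D ⊆ G ∧ D.Pairwise Disjoint} := by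
    refine ⟨insert_subset hWG hD.prop.1, ?_⟩
    refine hD.prop.2.insert_of_symm ?_
    intro W hW _
    rw [Set.disjoint_left]
    rintro y ⟨hyA, -⟩ hyW
    exact hdis W hW ⟨y, hyA, hyW⟩
  have : A ∩ N' ∈ D := hD.le_of_ge hins (subset_insert _ _) (mem_insert _ _)
  exact hdis _ this ⟨x, hxA, hxA, hxN'⟩

lemma aux_weak {X : Type*} [TopologicalSpace X] [FirstCountableTopology X]
    {M : Type*} [TopologicalSpace M] [MetrizableSpace M]
    (𝓦 : Set (Set M)) (h𝓦 : ∀ K : Set M, IsCompact K → ∀ O, IsOpen O → K ⊆ O →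
      ∃ W ∈ 𝓦, K ⊆ W ∧ W ⊆ O)
    (c : KM M → Set (Set X)) (hmono : ∀ p p' : KM M, p ≤ p' → c p ⊆ c p')
    (hlf : ∀ p, LocallyFiniteFamily (c p)) (x : X) (K : KM M) :
    ∃ W ∈ 𝓦, K.1 ⊆ W ∧ LocallyFiniteAt x {A | ∃ L : KM M, L.1 ⊆ W ∧ A ∈ c L} := by
  classical
  by_contra! hcon
  letI := metrizableSpaceMetric M
  obtain ⟨U, hU⟩ := (𝓝 x).exists_antitone_basis
  have hstep : ∀ k : ℕ, {A | (∃ L : KM M, L.1 ⊆ Metric.thickening (1 / ((k : ℝ) + 1)) K.1 ∧ A ∈ c L)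
      ∧ (A ∩ U k).Nonempty}.Infinite := by
    intro k hfin
    obtain ⟨W, hW, hKW, hWO⟩ := h𝓦 K.1 K.2 (Metric.thickening (1 / ((k : ℝ) + 1)) K.1)
      Metric.isOpen_thickening (Metric.self_subset_thickening (by positivity) _)
    refine hcon W hW hKW ⟨U k, hU.mem k, hfin.subset ?_⟩
    rintro A ⟨⟨L, hL, hA⟩, hne⟩
    exact ⟨⟨L, hL.trans hWO, hA⟩, hne⟩
  obtain ⟨f, hfP, hfr⟩ := exists_seq_of_forall_finset_exists
    (fun q : ℕ × Set X => (∃ L : KM M, L.1 ⊆ Metric.thickening (1 / ((q.1 : ℝ) + 1)) K.1 ∧ q.2 ∈ c L)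
      ∧ (q.2 ∩ U q.1).Nonempty)
    (fun q q' => q.1 < q'.1 ∧ q.2 ≠ q'.2) (by
      intro s _
      obtain ⟨A, hA, hAs⟩ := (hstep (s.sup Prod.fst + 1)).exists_notMem_finset (s.image Prod.snd)
      refine ⟨(s.sup Prod.fst + 1, A), hA, fun q hq => ⟨?_, ?_⟩⟩
      · exact Nat.lt_succ_of_le (Finset.le_sup (f := Prod.fst) hq)
      · rintro h
        exact hAs (Finset.mem_image.2 ⟨q, hq, h⟩))
  have hsm : StrictMono fun n => (f n).1 := fun m n h => (hfr m n h).1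
  have hinj : Function.Injective fun n => (f n).2 := by
    intro m n h
    rcases lt_trichotomy m n with h' | h' | h'
    · exact absurd h (hfr m n h').2
    · exact h'
    · exact absurd h.symm (hfr n m h').2
  choose hL hne using hfP
  choose L hLs hLc using hL
  have hcomp : IsCompact (K.1 ∪ ⋃ n, (L n).1) := by
    refine aux_compact_s16 K.2 _ (fun n => (L n).2) ?_
    intro O hO hKO
    obtain ⟨δ, hδ, hδO⟩ := K.2.exists_thickening_subset_open hO hKO
    obtain ⟨N, hN⟩ := exists_nat_one_div_lt hδ
    refine ⟨N, fun n hn => (hLs n).trans ((Metric.thickening_mono ?_ _).trans hδO)⟩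
    refine le_trans ?_ hN.le
    have : N ≤ (f n).1 := hn.trans (hsm.le_apply)
    have : (N : ℝ) ≤ (f n).1 := by exact_mod_cast this
    gcongr
  obtain ⟨N, hN, hfin⟩ := hlf ⟨_, hcomp⟩ x
  obtain ⟨k, -, hk⟩ := hU.toHasBasis.mem_iff.1 hN
  have hinf : ((fun n => (f n).2) '' Ici k).Infinite := (Ici_infinite k).image hinj.injOn
  refine hinf (hfin.subset ?_)
  rintro _ ⟨n, hn, rfl⟩
  refine ⟨hmono (L n) _ ?_ (hLc n), (hne n).mono ?_⟩
  · exact (subset_iUnion (fun n => (L n).1) n).trans subset_union_right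
  · refine inter_subset_inter_right _ ((hU.antitone ?_).trans hk)
    exact le_trans hn hsm.le_apply

/-- A ccc, first countable, 𝒦(𝓜)-paracompact Tychonoff space is
Lindelöf. -/
theorem statement16 (X : Type*) [TopologicalSpace X] [T35Space X]
    (hccc : CCC X) [FirstCountableTopology X] (hkm : KMclassParacompact X) :
    LindelofSpace X := by
  classical
  refine ⟨isLindelof_of_countable_subcover ?_⟩
  intro ι U hU hcov
  obtain ⟨M, _, hs, hm, V, hV, hVU, c, hmono, hlf, hcV⟩ := hkm (range U)
    ⟨by rintro _ ⟨i, rfl⟩; exact hU i, by rw [sUnion_range]; exact univ_subset_iff.1 hcov⟩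
  haveI : SecondCountableTopology M := by
    letI := metrizableSpaceMetric M
    exact UniformSpace.secondCountable_of_separable M
  obtain ⟨𝓦, h𝓦c, h𝓦⟩ := aux_basis (M := M)
  let d : Set M → Set (Set X) := fun W => {A | ∃ L : KM M, L.1 ⊆ W ∧ A ∈ c L}
  have hdV : ∀ W, d W ⊆ V := by
    rintro W A ⟨L, -, hA⟩
    exact hcV ▸ mem_iUnion_of_mem L hA
  let E : Set (Set X) := ⋃ W ∈ 𝓦, {A ∈ d W | ∃ x ∈ A, LocallyFiniteAt x (d W)}
  have hE : E.Countable := h𝓦c.biUnion fun W _ => aux_ccc hccc (d W) fun A hA => hV.1 A (hdV W hA)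
  have hEV : ∀ A ∈ E, ∃ i, A ⊆ U i := by
    intro A hA
    obtain ⟨W, _, hA, -⟩ := mem_iUnion₂.1 hA
    obtain ⟨_, ⟨i, rfl⟩, h⟩ := hVU A (hdV W hA)
    exact ⟨i, h⟩
  rcases isEmpty_or_nonempty ι with hι | hι
  · refine ⟨∅, countable_empty, fun x _ => ?_⟩
    obtain ⟨i, -⟩ := mem_iUnion.1 (hcov (mem_univ x))
    exact isEmptyElim i
  choose! g hg using hEV
  refine ⟨g '' E, hE.image g, fun x _ => ?_⟩
  obtain ⟨A, hA, hxA⟩ := mem_sUnion.1 (hV.2 ▸ mem_univ x : x ∈ ⋃₀ V)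
  obtain ⟨K, hK⟩ := mem_iUnion.1 (hcV ▸ hA : A ∈ ⋃ p, c p)
  obtain ⟨W, hW, hKW, hl⟩ := aux_weak 𝓦 h𝓦 c hmono hlf x K
  have hAE : A ∈ E := mem_biUnion hW ⟨⟨K, hKW, hK⟩, x, hxA, hl⟩
  exact mem_biUnion (mem_image_of_mem g hAE) (hg A hAE hxA)
end
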